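/- arXiv:1401.2621 — 2 statements merged into one kernel-verified Lean document; each statement's English description precedes it below -/
import Mathlib

section
/- Let M be an inverse monoid. The conjugacy relation ≈ on the set of closed inverse submonoids of M, defined by H ≈ K if and only if there exists m ∈ M such that m⁻¹ * h * m ∈ K for all h ∈ H and m * k * m⁻¹ ∈ H for all k ∈ K, is an equivalence relation (reflexive, symmetric, and transitive). -/
/-- `i` is the inverse operation of an inverse monoid structure on `M`. -/
def IsInverseMonoidInv (M : Type*) [Monoid M] (i : M → M) : Prop :=
  (∀ a : M, a * i a * a = a) ∧ (∀ a : M, i a * a * i a = i a) ∧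
    ∀ a b : M, a * b * a = a → b * a * b = b → b = i a

/-- The natural partial order on an inverse monoid. -/
def natLe {M : Type*} [Monoid M] (a b : M) : Prop :=
  ∃ e : M, e * e = e ∧ a = e * b

/-- `N^ω`, the set of elements lying above some element of `N`. -/
def omegaClosure {M : Type*} [Monoid M] (N : Set M) : Set M :=
  {m | ∃ n ∈ N, natLe n m}

/-- `H` is a closed inverse submonoid of the inverse monoid `M`. -/
def IsClosedInvSubmonoid {M : Type*} [Monoid M] (i : M → M) (H : Set M) : Prop :=
  (1 : M) ∈ H ∧ (∀ a ∈ H, ∀ b ∈ H, a * b ∈ H) ∧ (∀ a ∈ H, i a ∈ H) ∧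
    omegaClosure H ⊆ H

/-- `H ≈ K`: the closed inverse submonoids `H` and `K` are conjugate, i.e. there
is `m ∈ M` with `m⁻¹ H m ⊆ K` and `m K m⁻¹ ⊆ H`. -/
def ConjRel {M : Type*} [Monoid M] (i : M → M) (H K : Set M) : Prop :=
  ∃ m : M, (∀ h ∈ H, i m * h * m ∈ K) ∧ (∀ k ∈ K, m * k * i m ∈ H)

/-- In an inverse monoid the product of two idempotents is idempotent. -/
theorem aux_idem_mul {M : Type*} [Monoid M] (i : M → M)
    (hi : IsInverseMonoidInv M i) (e f : M) (he : e * e = e) (hf : f * f = f) :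
    e * f * (e * f) = e * f := by
  obtain ⟨h1, h2, h3⟩ := hi
  obtain ⟨x, hx⟩ : ∃ x, x = i (e * f) := ⟨_, rfl⟩
  have a1 : e * f * x * (e * f) = e * f := hx ▸ h1 (e * f)
  have a2 : x * (e * f) * x = x := hx ▸ h2 (e * f)
  have b : f * x * e = x := by
    rw [hx]
    apply h3 <;> rw [← hx]
    · calc e * f * (f * x * e) * (e * f) = e * (f * f) * x * ((e * e) * f) := by
            simp only [mul_assoc]
        _ = e * f := by rw [he, hf, a1]
    · calc f * x * e * (e * f) * (f * x * e) = f * (x * ((e * e) * (f * f)) * x) * e := by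
            simp only [mul_assoc]
        _ = f * x * e := by rw [he, hf, a2]
  have xx : x * x = x := by
    calc x * x = (f * x * e) * (f * x * e) := by rw [b]
      _ = f * (x * (e * f) * x) * e := by simp only [mul_assoc]
      _ = x := by rw [a2, b]
  have c1 : x = i x := h3 x x (by rw [xx, xx]) (by rw [xx, xx])
  have c2 : e * f = i x := h3 x (e * f) a2 a1
  rw [c2, ← c1, xx]

/-- In an inverse monoid idempotents commute. -/
theorem aux_idem_comm {M : Type*} [Monoid M] (i : M → M)
    (hi : IsInverseMonoidInv M i) (e f : M) (he : e * e = e) (hf : f * f = f) :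
    e * f = f * e := by
  have key : ∀ e f : M, e * e = e → f * f = f → e * f * (f * e) * (e * f) = e * f := by
    intro e f he hf
    calc e * f * (f * e) * (e * f) = e * (f * f) * ((e * e) * f) := by simp only [mul_assoc]
      _ = e * f := by rw [he, hf, aux_idem_mul i hi e f he hf]
  have p := aux_idem_mul i hi e f he hf
  have h3 := hi.2.2
  rw [h3 (e * f) (f * e) (key e f he hf) (key f e hf he)]
  exact h3 _ _ (by rw [p, p]) (by rw [p, p])

/-- The inverse is an involution. -/
theorem aux_inv_inv {M : Type*} [Monoid M] (i : M → M)
    (hi : IsInverseMonoidInv M i) (a : M) : i (i a) = a :=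
  (hi.2.2 (i a) a (hi.2.1 a) (hi.1 a)).symm

/-- The inverse reverses products. -/
theorem aux_inv_mul {M : Type*} [Monoid M] (i : M → M)
    (hi : IsInverseMonoidInv M i) (a b : M) : i (a * b) = i b * i a := by
  have h1 := hi.1
  have h2 := hi.2.1
  have c : (b * i b) * (i a * a) = (i a * a) * (b * i b) := by
    apply aux_idem_comm i hi
    · rw [← mul_assoc, h1]
    · rw [← mul_assoc, h2]
  symm
  apply hi.2.2
  · calc a * b * (i b * i a) * (a * b) = a * ((b * i b) * (i a * a)) * b := by
          simp only [mul_assoc]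
      _ = (a * i a * a) * (b * i b * b) := by rw [c]; simp only [mul_assoc]
      _ = a * b := by rw [h1, h1]
  · calc i b * i a * (a * b) * (i b * i a) = i b * ((i a * a) * (b * i b)) * i a := by
          simp only [mul_assoc]
      _ = (i b * b * i b) * (i a * a * i a) := by rw [← c]; simp only [mul_assoc]
      _ = i b * i a := by rw [h2, h2]

/-- Conjugacy of closed inverse submonoids of an inverse monoid is an
equivalence relation: reflexive, symmetric and transitive. -/
theorem conjRel_equivalence {M : Type*} [Monoid M] (i : M → M)
    (hi : IsInverseMonoidInv M i) :
    (∀ H : Set M, IsClosedInvSubmonoid i H → ConjRel i H H) ∧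
    (∀ H K : Set M, IsClosedInvSubmonoid i H → IsClosedInvSubmonoid i K →
      ConjRel i H K → ConjRel i K H) ∧
    (∀ H K L : Set M, IsClosedInvSubmonoid i H → IsClosedInvSubmonoid i K →
      IsClosedInvSubmonoid i L → ConjRel i H K → ConjRel i K L → ConjRel i H L) := by
  refine ⟨?_, ?_, ?_⟩
  · intro H _
    have h1 : i 1 = 1 := (hi.2.2 1 1 (by simp) (by simp)).symm
    exact ⟨1, fun h hh => by simpa [h1] using hh, fun h hh => by simpa [h1] using hh⟩
  · rintro H K _ _ ⟨m, h1, h2⟩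
    refine ⟨i m, ?_, ?_⟩ <;> rw [aux_inv_inv i hi]
    · exact h2
    · exact h1
  · rintro H K L _ _ _ ⟨m, h1, h2⟩ ⟨n, h3, h4⟩
    refine ⟨m * n, ?_, ?_⟩ <;> rw [aux_inv_mul i hi]
    · intro h hh
      have := h3 _ (h1 h hh)
      simpa only [mul_assoc] using this
    · intro h hh
      have := h2 _ (h4 h hh)
      simpa only [mul_assoc] using this
end

section
/- Let H be a closed inverse submonoid of an inverse monoid M, and let Y = (H a)^ω and Z = (H b)^ω be right ω-cosets of H (so a * a⁻¹ ∈ H and b * b⁻¹ ∈ H). Then (Y · (a⁻¹ * b))^ω = Z, where Y · m = {y * m : y ∈ Y}. In particular, the action of M on the right ω-cosets of H by Y ↦ (Y m)^ω is transitive. -/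
/-- Products of idempotents are idempotent. -/
theorem idem_mul {M : Type*} [Monoid M] {i : M → M} (hi : IsInverseMonoidInv M i)
    {e f : M} (he : e * e = e) (hf : f * f = f) : (e * f) * (e * f) = e * f := by
  obtain ⟨h1, h2, h3⟩ := hi
  have p := h1 (e * f)
  have q := h2 (e * f)
  have r := h3 (e * f) (f * i (e * f) * e)
    (by
      calc e * f * (f * i (e * f) * e) * (e * f)
          = e * (f * f) * i (e * f) * ((e * e) * f) := by simp only [mul_assoc]
        _ = e * f := by rw [he, hf, p])
    (by
      calc f * i (e * f) * e * (e * f) * (f * i (e * f) * e)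
          = f * (i (e * f) * ((e * e) * (f * f)) * i (e * f)) * e := by simp only [mul_assoc]
        _ = f * i (e * f) * e := by rw [he, hf, q])
  have s : i (e * f) * i (e * f) = i (e * f) := by
    calc i (e * f) * i (e * f)
        = (f * i (e * f) * e) * (f * i (e * f) * e) := by rw [r]
      _ = f * (i (e * f) * (e * f) * i (e * f)) * e := by simp only [mul_assoc]
      _ = i (e * f) := by rw [q, r]
  have t := h3 (i (e * f)) (e * f) q p
  have u := h3 (i (e * f)) (i (e * f)) (by rw [s, s]) (by rw [s, s])
  rw [t, ← u, s]

/-- Idempotents commute. -/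
theorem idem_comm {M : Type*} [Monoid M] {i : M → M} (hi : IsInverseMonoidInv M i)
    {e f : M} (he : e * e = e) (hf : f * f = f) : e * f = f * e := by
  have p := idem_mul hi he hf
  have q := idem_mul hi hf he
  obtain ⟨h1, h2, h3⟩ := hi
  have t := h3 (e * f) (e * f) (by rw [p, p]) (by rw [p, p])
  have u := h3 (e * f) (f * e)
    (by
      calc e * f * (f * e) * (e * f) = e * (f * f) * ((e * e) * f) := by simp only [mul_assoc]
        _ = e * f := by rw [he, hf, p])
    (by
      calc f * e * (e * f) * (f * e) = f * (e * e) * ((f * f) * e) := by simp only [mul_assoc]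
        _ = f * e := by rw [he, hf, q])
  rw [t, ← u]

/-- If `Y = (H a)^ω` and `Z = (H b)^ω` are right ω-cosets of a closed inverse
submonoid `H`, then `(Y · (a⁻¹ b))^ω = Z`; hence the action of `M` on the right
ω-cosets of `H` is transitive. -/
theorem coset_action_transitive {M : Type*} [Monoid M] (i : M → M)
    (hi : IsInverseMonoidInv M i) (H : Set M)
    (hH : IsClosedInvSubmonoid i H) (a b : M)
    (ha : a * i a ∈ H) (hb : b * i b ∈ H) :
    omegaClosure ((· * (i a * b)) '' omegaClosure ((· * a) '' H)) =
      omegaClosure ((· * b) '' H) := by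
  obtain ⟨_, hmul, _, _⟩ := hH
  ext x
  constructor
  · rintro ⟨_, ⟨y, ⟨_, ⟨h, hh, rfl⟩, f, hf, hfy⟩, rfl⟩, e, he, hex⟩
    refine ⟨h * (a * i a) * b, ⟨_, hmul _ hh _ ha, rfl⟩, f * e, idem_mul hi hf he, ?_⟩
    calc h * (a * i a) * b = (h * a) * (i a * b) := by simp only [mul_assoc]
      _ = (f * y) * (i a * b) := congrArg (· * (i a * b)) hfy
      _ = f * (y * (i a * b)) := mul_assoc _ _ _
      _ = f * (e * x) := congrArg (f * ·) hex
      _ = f * e * x := (mul_assoc _ _ _).symm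
  · rintro ⟨_, ⟨h, hh, rfl⟩, e, he, hex⟩
    have hg : (a * i a) * (a * i a) = a * i a := by rw [← mul_assoc, hi.1]
    have hk : (i h * h) * (i h * h) = i h * h := by rw [← mul_assoc, hi.2.1]
    have hc := idem_comm hi hg hk
    have key : h * (a * i a) * i h * h = h * (a * i a) := by
      calc h * (a * i a) * i h * h = h * ((a * i a) * (i h * h)) := by simp only [mul_assoc]
        _ = h * i h * h * (a * i a) := by rw [hc]; simp only [mul_assoc]
        _ = h * (a * i a) := by rw [hi.1]
    have hid : (h * (a * i a) * i h) * (h * (a * i a) * i h) = h * (a * i a) * i h := by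
      calc (h * (a * i a) * i h) * (h * (a * i a) * i h)
          = (h * (a * i a) * i h * h) * (a * i a) * i h := by simp only [mul_assoc]
        _ = h * ((a * i a) * (a * i a)) * i h := by rw [key]; simp only [mul_assoc]
        _ = _ := by rw [hg]
    refine ⟨h * a * (i a * b), ⟨h * a, ⟨h * a, ⟨h, hh, rfl⟩, 1, one_mul 1, (one_mul _).symm⟩, rfl⟩,
      (h * (a * i a) * i h) * e, idem_mul hi hid he, ?_⟩
    calc h * a * (i a * b) = h * (a * i a) * b := by simp only [mul_assoc]
      _ = (h * (a * i a) * i h * h) * b := by rw [key]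
      _ = (h * (a * i a) * i h) * (h * b) := mul_assoc _ _ _
      _ = (h * (a * i a) * i h) * (e * x) := congrArg ((h * (a * i a) * i h) * ·) hex
      _ = _ := (mul_assoc _ _ _).symm
end
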